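/- Let p ∈ ℝ^{d_p} and q ∈ ℝ^{d_q} be probability distributions with H(p) > 0, H(q) > 0, V(p) = 0 and V(q) > 0, and let s denote a sharp distribution. Let (t_n) be a moderate sequence and set ε_n = e^{−n t_n²}. For ε ≥ 0 define R_n^{ent}(ε) = (1/n)·sup{ m ∈ ℕ : p^{⊗n} ⊗ s^{⊗m} ≺_ε q^{⊗m} ⊗ s^{⊗n} }, where ≺_ε is approximate majorisation with total variation error. Then lim_{n→∞} ( R_n^{ent}(ε_n) − H(p)/H(q) ) / t_n = −√( 2 V(q) H(p) / H(q)³ ). -/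

import Mathlib

open Finset Filter Real Topology

noncomputable section

/-- A probability distribution on a finite type: nonnegative entries summing to 1. -/
def IsProbDist {α : Type*} [Fintype α] (a : α → ℝ) : Prop :=
  (∀ i, 0 ≤ a i) ∧ ∑ i, a i = 1

/-- A sharp distribution: a single entry equal to 1, all others 0. -/
def IsSharp {α : Type*} [Fintype α] (a : α → ℝ) : Prop :=
  ∃ i, a i = 1 ∧ ∀ j, j ≠ i → a j = 0

/-- The uniform distribution: all entries equal to `1 / |α|`. -/
def IsUniform {α : Type*} [Fintype α] (a : α → ℝ) : Prop :=
  ∀ i, a i = 1 / (Fintype.card α : ℝ)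

/-- Tensor (Kronecker) product of two vectors. -/
def tensor {α β : Type*} (a : α → ℝ) (b : β → ℝ) : α × β → ℝ :=
  fun x => a x.1 * b x.2

/-- `n`-fold tensor power of a vector. -/
def tpow {α : Type*} (a : α → ℝ) (n : ℕ) : (Fin n → α) → ℝ :=
  fun f => ∏ j, a (f j)

/-- Shannon entropy (natural logarithm, with the convention `0 · ln 0 = 0`). -/
def shannonH {α : Type*} [Fintype α] (a : α → ℝ) : ℝ :=
  -∑ i, a i * Real.log (a i)

/-- Entropy variance `V(a) = ∑ i, a i (ln a i + H(a))²`. -/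
def entV {α : Type*} [Fintype α] (a : α → ℝ) : ℝ :=
  ∑ i, a i * (Real.log (a i) + shannonH a) ^ 2

/-- Relative entropy `D(a‖b)`. -/
def relD {α : Type*} [Fintype α] (a b : α → ℝ) : ℝ :=
  ∑ i, a i * Real.log (a i / b i)

/-- Relative entropy variance `V(a‖b)`. -/
def relV {α : Type*} [Fintype α] (a b : α → ℝ) : ℝ :=
  ∑ i, a i * (Real.log (a i / b i) - relD a b) ^ 2

/-- Total variation distance. -/
def tvd {α : Type*} [Fintype α] (a b : α → ℝ) : ℝ :=
  (1 / 2) * ∑ i, |a i - b i|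

/-- Fidelity `F(a,b) = (∑ i √(a i · b i))²`. -/
def fid {α : Type*} [Fintype α] (a b : α → ℝ) : ℝ :=
  (∑ i, Real.sqrt (a i * b i)) ^ 2

/-- The entries of `a` sorted in non-increasing order, as a vector on `Fin (card α)`. -/
def descSorted {α : Type*} [Fintype α] (a : α → ℝ) : Fin (Fintype.card α) → ℝ :=
  fun i =>
    a ((Fintype.equivFin α).symm
      (Tuple.sort (fun j => -a ((Fintype.equivFin α).symm j)) i))

/-- `headSum a K = ∑_{1 ≤ i ≤ K} a^↓_i` (1-based indices `i`, comparison `(i : ℝ) ≤ K`,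
equivalently `i ≤ ⌊K⌋`). -/
def headSum {α : Type*} [Fintype α] (a : α → ℝ) (K : ℝ) : ℝ :=
  ∑ i ∈ Finset.univ.filter (fun i : Fin (Fintype.card α) => ((i : ℕ) + 1 : ℝ) ≤ K),
    descSorted a i

/-- `tailSum a K = ∑_{i ≥ K} a^↓_i` (1-based indices `i`, comparison `K ≤ (i : ℝ)`,
equivalently `i ≥ ⌈K⌉`). -/
def tailSum {α : Type*} [Fintype α] (a : α → ℝ) (K : ℝ) : ℝ :=
  ∑ i ∈ Finset.univ.filter (fun i : Fin (Fintype.card α) => K ≤ ((i : ℕ) + 1 : ℝ)),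
    descSorted a i

/-- `a` majorises `b` (written `a ≻ b`): every partial sum of the non-increasingly sorted
`a` dominates the corresponding partial sum of sorted `b` (shorter vectors padded with zeros). -/
def Maj {α β : Type*} [Fintype α] [Fintype β] (a : α → ℝ) (b : β → ℝ) : Prop :=
  ∀ j : ℕ, headSum b (j : ℝ) ≤ headSum a (j : ℝ)

/-- `a ≻_ε b`: approximate majorisation (from above) with total variation error:
there is a probability distribution `b̃` with `a ≻ b̃` and `δ(b, b̃) ≤ ε`. -/
def ApproxMajTV {α β : Type*} [Fintype α] [Fintype β] (a : α → ℝ) (b : β → ℝ) (ε : ℝ) : Prop :=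
  ∃ bt : β → ℝ, IsProbDist bt ∧ Maj a bt ∧ tvd b bt ≤ ε

/-- `a ≺_ε b`: approximate majorisation (from below) with total variation error:
there is a probability distribution `b̃` with `a ≺ b̃` and `δ(b, b̃) ≤ ε`. -/
def ApproxSubMajTV {α β : Type*} [Fintype α] [Fintype β] (a : α → ℝ) (b : β → ℝ) (ε : ℝ) : Prop :=
  ∃ bt : β → ℝ, IsProbDist bt ∧ Maj bt a ∧ tvd b bt ≤ ε

/-- A moderate sequence: `t n → 0` and `√n · t n → +∞`. -/
def ModerateSeq (t : ℕ → ℝ) : Prop :=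
  Tendsto t atTop (𝓝 0) ∧ Tendsto (fun n : ℕ => Real.sqrt (n : ℝ) * t n) atTop atTop

/-- The uniform distribution on `Fin d`. -/
def unif (d : ℕ) : Fin d → ℝ := fun _ => 1 / (d : ℝ)

/-- The embedding map `Γ` associated with `γ_i = c_i / N`: for each `i` it produces
`c_i` entries equal to `a_i / c_i`. -/
def embed {d : ℕ} (c : Fin d → ℕ) (a : Fin d → ℝ) : (Σ i : Fin d, Fin (c i)) → ℝ :=
  fun x => a x.1 / (c x.1 : ℝ)

/-- Cut-and-pile modification of the sorted version of `a`, with cut at `K`: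
the first entry absorbs the total mass of entries at (1-based) positions `≥ K`,
entries at positions `1 < i < K` are unchanged, and entries at positions `≥ K` are set to 0. -/
def cutAndPile {α : Type*} [Fintype α] (a : α → ℝ) (K : ℝ) : Fin (Fintype.card α) → ℝ :=
  fun i =>
    if (i : ℕ) = 0 then descSorted a i + tailSum a K
    else if ((i : ℕ) + 1 : ℝ) < K then descSorted a i else 0

lemma headSum_eq_sum_of_card_le {α : Type*} [Fintype α] (a : α → ℝ) (j : ℕ) :
    ∃ B : Finset α, B.card ≤ j ∧ headSum a j = ∑ x ∈ B, a x := by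
  classical
  let e : Fin (Fintype.card α) ≃ α :=
    (Tuple.sort (fun j => -a ((Fintype.equivFin α).symm j))).trans (Fintype.equivFin α).symm
  refine ⟨(univ.filter (fun i : Fin (Fintype.card α) => ((i : ℕ) + 1 : ℝ) ≤ j)).map
    e.toEmbedding, ?_, ?_⟩
  · rw [card_map]
    calc _ ≤ (Finset.range j).card := by
          refine Finset.card_le_card_of_injOn (fun i => (i : ℕ)) ?_ (fun _ _ _ _ h => Fin.ext h)
          intro i hi
          simp only [coe_filter, mem_univ, true_and, Set.mem_ofPred_eq] at hi
          have : (i : ℕ) + 1 ≤ j := by exact_mod_cast hi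
          simp only [coe_range, Set.mem_Iio]
          omega
      _ = j := Finset.card_range j
  · rw [sum_map]
    rfl

lemma antitone_descSorted {α : Type*} [Fintype α] (a : α → ℝ) : Antitone (descSorted a) := by
  intro i j hij
  have := Tuple.monotone_sort (fun j => -a ((Fintype.equivFin α).symm j)) hij
  simpa [descSorted] using this

lemma sum_le_headSum {α : Type*} [Fintype α] (a : α → ℝ) (ha : ∀ x, 0 ≤ a x) (B : Finset α)
    (j : ℕ) (hB : B.card ≤ j) : ∑ x ∈ B, a x ≤ headSum a j := by
  classical
  let e : Fin (Fintype.card α) ≃ α :=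
    (Tuple.sort (fun j => -a ((Fintype.equivFin α).symm j))).trans (Fintype.equivFin α).symm
  have hd : ∀ i, descSorted a i = a (e i) := fun i => rfl
  set C := B.map e.symm.toEmbedding with hC
  have hCc : C.card ≤ j := by rw [hC, card_map]; exact hB
  have hsum : ∑ x ∈ B, a x = ∑ i ∈ C, descSorted a i := by
    rw [hC, sum_map]
    exact sum_congr rfl fun x _ => by simp [hd]
  set F := univ.filter (fun i : Fin (Fintype.card α) => ((i : ℕ) + 1 : ℝ) ≤ j) with hF
  have hmem : ∀ i, i ∈ F ↔ (i : ℕ) < j := by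
    intro i
    simp only [hF, mem_filter, mem_univ, true_and]
    exact_mod_cast Iff.rfl
  have hnn : ∀ i, 0 ≤ descSorted a i := fun i => ha _
  rw [hsum]
  change _ ≤ ∑ i ∈ F, descSorted a i
  by_cases hj : j < Fintype.card α
  · have hFc : F.card = j := by
      have : F = Finset.Iio (⟨j, hj⟩ : Fin _) := by
        ext i
        rw [hmem, Finset.mem_Iio, Fin.lt_def]
      rw [this, Fin.card_Iio]
    set τ := descSorted a ⟨j, hj⟩
    have h1 : ∑ i ∈ C \ F, descSorted a i ≤ (C \ F).card • τ := by
      refine sum_le_card_nsmul _ _ _ fun i hi => antitone_descSorted a ?_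
      rw [Finset.mem_sdiff, hmem, not_lt] at hi
      exact hi.2
    have h2 : (F \ C).card • τ ≤ ∑ i ∈ F \ C, descSorted a i := by
      refine card_nsmul_le_sum _ _ _ fun i hi => antitone_descSorted a ?_
      rw [Finset.mem_sdiff, hmem] at hi
      exact hi.1.le
    have h3 : (C \ F).card ≤ (F \ C).card := by
      have h4 := card_sdiff_add_card_inter C F
      have h5 := card_sdiff_add_card_inter F C
      rw [inter_comm] at h5
      omega
    have h6 : (C \ F).card • τ ≤ (F \ C).card • τ := nsmul_le_nsmul_left (hnn _) h3
    have h7 := sum_inter_add_sum_sdiff C F (descSorted a)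
    have h8 := sum_inter_add_sum_sdiff F C (descSorted a)
    rw [inter_comm] at h8
    linarith
  · refine sum_le_sum_of_subset_of_nonneg (fun i _ => ?_) fun i _ _ => hnn i
    rw [hmem]
    omega

lemma exists_subset_card_mul_sum_le {α : Type*} (a : α → ℝ) (j : ℕ) (B : Finset α)
    (hj : j ≤ B.card) :
    ∃ C ⊆ B, C.card = j ∧ (j : ℝ) * ∑ x ∈ B, a x ≤ B.card * ∑ x ∈ C, a x := by
  classical
  induction hr : B.card - j generalizing B with
  | zero =>
    have : B.card = j := by omega
    exact ⟨B, Subset.rfl, this, by rw [this]⟩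
  | succ r ih =>
    obtain ⟨x, hx, hmin⟩ := exists_min_image B a (card_pos.mp (by omega))
    have hc := card_erase_of_mem hx
    obtain ⟨C, hCB, hCc, hC⟩ := ih (B.erase x) (by omega) (by omega)
    refine ⟨C, hCB.trans (erase_subset _ _), hCc, ?_⟩
    have h1 : ∑ y ∈ B, a y = ∑ y ∈ B.erase x, a y + a x := (sum_erase_add B a hx).symm
    have hge : ((B.erase x).card : ℝ) * a x ≤ ∑ y ∈ B.erase x, a y := by
      rw [← nsmul_eq_mul]
      exact card_nsmul_le_sum _ _ _ fun y hy => hmin y (mem_of_mem_erase hy)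
    have hB : (B.card : ℝ) = (B.erase x).card + 1 := by
      rw [hc]; push_cast [Nat.one_le_iff_ne_zero.mpr (by omega : B.card ≠ 0)]; ring
    have hcx : (j : ℝ) * a x ≤ ∑ y ∈ C, a y := by
      rw [← hCc, ← nsmul_eq_mul]
      exact card_nsmul_le_sum _ _ _ fun y hy => hmin y (mem_of_mem_erase (hCB hy))
    rw [h1, hB]
    linarith

lemma sum_sub_le_tvd {α : Type*} [Fintype α] {b c : α → ℝ} (hb : IsProbDist b)
    (hc : IsProbDist c) (B : Finset α) : ∑ x ∈ B, c x - ∑ x ∈ B, b x ≤ tvd b c := by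
  classical
  have h1 := sum_add_sum_compl B b
  have h2 := sum_add_sum_compl B c
  have h3 := sum_add_sum_compl B (fun x => |b x - c x|)
  have h4 : ∑ x ∈ B, (c x - b x) ≤ ∑ x ∈ B, |b x - c x| :=
    sum_le_sum fun x _ => by rw [abs_sub_comm]; exact le_abs_self _
  have h5 : ∑ x ∈ Bᶜ, (b x - c x) ≤ ∑ x ∈ Bᶜ, |b x - c x| :=
    sum_le_sum fun x _ => le_abs_self _
  rw [sum_sub_distrib] at h4 h5
  rw [hb.2] at h1
  rw [hc.2] at h2
  unfold tvd
  linarith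

lemma exists_finset_of_approxSubMajTV {α β : Type*} [Fintype α] [Fintype β] {a : α → ℝ}
    {b : β → ℝ} {u e : ℝ} (ha : IsProbDist a) (hflat : ∀ x, a x = 0 ∨ a x = u)
    (hb : IsProbDist b) (h : ApproxSubMajTV a b e) :
    ∃ B : Finset β, (B.card : ℝ) * u ≤ 1 ∧ 1 - e ≤ ∑ x ∈ B, b x := by
  classical
  obtain ⟨c, hc, hmaj, htv⟩ := h
  set T := univ.filter (fun x => a x ≠ 0) with hT
  have hTs : ∑ x ∈ T, a x = 1 := by rw [← ha.2, hT, sum_filter_ne_zero]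
  have hTu : (T.card : ℝ) * u = 1 := by
    rw [← hTs, ← nsmul_eq_mul, ← sum_const]
    refine sum_congr rfl fun x hx => ?_
    rw [hT, mem_filter] at hx
    exact ((hflat x).resolve_left hx.2).symm
  have hu : 0 ≤ u := by
    by_contra hu
    nlinarith [(Nat.cast_nonneg T.card : (0 : ℝ) ≤ T.card)]
  obtain ⟨B, hBc, hB⟩ := headSum_eq_sum_of_card_le c T.card
  refine ⟨B, ?_, ?_⟩
  · rw [← hTu]
    gcongr
  · have h1 := hmaj T.card
    have h2 := sum_le_headSum a ha.1 T T.card le_rfl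
    have h3 := sum_sub_le_tvd hb hc B
    linarith

lemma approxSubMajTV_of_finset {α β : Type*} [Fintype α] [Fintype β] {a : α → ℝ}
    {b : β → ℝ} {u e : ℝ} (ha : IsProbDist a) (hu : 0 ≤ u) (hle : ∀ x, a x ≤ u)
    (hb : IsProbDist b) (B : Finset β) (hne : B.Nonempty) (hBu : (B.card : ℝ) * u ≤ 1)
    (hBs : 1 - e ≤ ∑ x ∈ B, b x) : ApproxSubMajTV a b e := by
  classical
  obtain ⟨z, hz⟩ := hne
  set r := 1 - ∑ x ∈ B, b x with hr
  have hr0 : 0 ≤ r := by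
    rw [hr, sub_nonneg, ← hb.2]
    exact sum_le_sum_of_subset_of_nonneg (subset_univ _) fun i _ _ => hb.1 i
  set c : β → ℝ := fun x => (if x ∈ B then b x else 0) + (if x = z then r else 0) with hc
  have hc0 : ∀ x, 0 ≤ c x := fun x => by
    have := hb.1 x
    simp only [hc]
    split_ifs <;> linarith
  have hcB : ∑ x ∈ B, c x = 1 := by
    simp only [hc, sum_add_distrib, sum_ite_eq', hz, if_true]
    rw [sum_congr rfl fun x hx => if_pos hx]
    linarith
  have hcs : ∑ x, c x = 1 := by
    rw [← hcB]
    refine (sum_subset (subset_univ _) fun x _ hx => ?_).symm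
    have : x ≠ z := fun h => hx (h ▸ hz)
    simp [hc, hx, this]
  refine ⟨c, ⟨hc0, hcs⟩, fun j => ?_, ?_⟩
  · obtain ⟨A, hAc, hA⟩ := headSum_eq_sum_of_card_le a j
    rw [hA]
    have hA1 : ∑ x ∈ A, a x ≤ 1 := by
      rw [← ha.2]
      exact sum_le_sum_of_subset_of_nonneg (subset_univ _) fun i _ _ => ha.1 i
    rcases le_total B.card j with hj | hj
    · exact hA1.trans (hcB.symm.le.trans (sum_le_headSum c hc0 B j hj))
    · obtain ⟨C, -, hCc, hC⟩ := exists_subset_card_mul_sum_le c j B hj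
      rw [hcB, mul_one] at hC
      have h1 : ∑ x ∈ A, a x ≤ j * u := by
        calc ∑ x ∈ A, a x ≤ A.card • u := sum_le_card_nsmul _ _ _ fun x _ => hle x
          _ = A.card * u := nsmul_eq_mul _ _
          _ ≤ j * u := by gcongr
      have h2 := sum_le_headSum c hc0 C j hCc.le
      have h3 : 0 ≤ ∑ x ∈ C, c x := sum_nonneg fun x _ => hc0 x
      nlinarith [mul_le_mul_of_nonneg_right hC hu, mul_le_mul_of_nonneg_right hBu h3]
  · have h1 : ∀ x, |b x - c x| ≤ (b x - if x ∈ B then b x else 0) + if x = z then r else 0 := by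
      intro x
      have := hb.1 x
      simp only [hc, abs_le]
      split_ifs <;> constructor <;> linarith
    have h2 := sum_le_sum (s := univ) fun x _ => h1 x
    rw [sum_add_distrib, sum_sub_distrib, hb.2, sum_ite_eq', if_pos (mem_univ _),
      sum_ite_mem, univ_inter] at h2
    unfold tvd
    linarith

lemma isProbDist_tpow {d : ℕ} {q : Fin d → ℝ} (hq : IsProbDist q) (m : ℕ) :
    IsProbDist (tpow q m) := by
  refine ⟨fun x => prod_nonneg fun j _ => hq.1 _, ?_⟩
  have := Fintype.sum_pow q m
  rw [hq.2, one_pow] at this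
  exact this.symm

lemma isProbDist_tensor {α β : Type*} [Fintype α] [Fintype β] {a : α → ℝ} {b : β → ℝ}
    (ha : IsProbDist a) (hb : IsProbDist b) : IsProbDist (tensor a b) := by
  refine ⟨fun x => mul_nonneg (ha.1 _) (hb.1 _), ?_⟩
  rw [← one_mul (1 : ℝ)]
  nth_rw 1 [← ha.2]
  rw [← hb.2, Fintype.sum_mul_sum, ← Fintype.sum_prod_type']
  rfl

lemma sum_tensor_le_sum_image_fst {α β : Type*} [Fintype α] [Fintype β] [DecidableEq α]
    {a : α → ℝ} {b : β → ℝ} (ha : ∀ x, 0 ≤ a x) (hb : IsProbDist b) (B : Finset (α × β)) :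
    ∑ x ∈ B, tensor a b x ≤ ∑ x ∈ B.image Prod.fst, a x := by
  classical
  calc ∑ x ∈ B, tensor a b x ≤ ∑ x ∈ B.image Prod.fst ×ˢ univ, tensor a b x := by
        refine sum_le_sum_of_subset_of_nonneg (fun x hx => ?_)
          fun x _ _ => mul_nonneg (ha _) (hb.1 _)
        simpa using ⟨x.2, hx⟩
    _ = ∑ x ∈ B.image Prod.fst, a x := by
        rw [sum_product]
        refine sum_congr rfl fun x _ => ?_
        simp only [tensor]
        rw [← mul_sum, hb.2, mul_one]

lemma exists_finset_tpow_of_succ {d : ℕ} {q : Fin d → ℝ} (hq : IsProbDist q) {m : ℕ} {u r : ℝ}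
    (hu : 0 ≤ u) (h : ∃ A : Finset (Fin (m + 1) → Fin d),
      (A.card : ℝ) * u ≤ 1 ∧ r ≤ ∑ x ∈ A, tpow q (m + 1) x) :
    ∃ A : Finset (Fin m → Fin d), (A.card : ℝ) * u ≤ 1 ∧ r ≤ ∑ x ∈ A, tpow q m x := by
  classical
  obtain ⟨A, hA, hs⟩ := h
  let φ : (Fin (m + 1) → Fin d) → (Fin m → Fin d) × Fin d := fun x => (Fin.tail x, x 0)
  have hφ : Function.Injective φ := by
    intro x y hxy
    simp only [φ, Prod.mk.injEq] at hxy
    rw [← Fin.cons_self_tail x, ← Fin.cons_self_tail y, hxy.1, hxy.2]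
  refine ⟨(A.image φ).image Prod.fst, ?_, ?_⟩
  · refine le_trans ?_ hA
    gcongr
    exact card_image_le.trans card_image_le
  · refine le_trans (hs.trans (le_of_eq ?_))
      (sum_tensor_le_sum_image_fst (isProbDist_tpow hq m).1 hq (A.image φ))
    rw [sum_image hφ.injOn]
    refine sum_congr rfl fun x _ => ?_
    simp only [tpow, tensor, φ, Fin.prod_univ_succ, Fin.tail]
    rw [mul_comm]

lemma exists_finset_tpow_mono {d : ℕ} {q : Fin d → ℝ} (hq : IsProbDist q) {m k : ℕ} {u r : ℝ}
    (hu : 0 ≤ u) (hmk : m ≤ k) (h : ∃ A : Finset (Fin k → Fin d),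
      (A.card : ℝ) * u ≤ 1 ∧ r ≤ ∑ x ∈ A, tpow q k x) :
    ∃ A : Finset (Fin m → Fin d), (A.card : ℝ) * u ≤ 1 ∧ r ≤ ∑ x ∈ A, tpow q m x := by
  induction k, hmk using Nat.le_induction with
  | base => exact h
  | succ k _ ih => exact ih (exists_finset_tpow_of_succ hq hu h)

lemma eq_zero_or_eq_exp_of_entV_eq_zero {d : ℕ} {p : Fin d → ℝ} (hp : IsProbDist p)
    (hV : entV p = 0) (i : Fin d) : p i = 0 ∨ p i = Real.exp (-shannonH p) := by
  unfold entV at hV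
  rw [sum_eq_zero_iff_of_nonneg fun i _ => mul_nonneg (hp.1 i) (sq_nonneg _)] at hV
  rcases (hp.1 i).eq_or_lt with h | h
  · exact Or.inl h.symm
  · right
    have h1 := hV i (mem_univ _)
    have h2 : Real.log (p i) + shannonH p = 0 := by
      rcases mul_eq_zero.mp h1 with h3 | h3
      · exact absurd h3 h.ne'
      · exact pow_eq_zero_iff two_ne_zero |>.mp h3
    rw [show -shannonH p = Real.log (p i) by linarith, Real.exp_log h]

lemma tpow_eq_zero_or_eq_pow {d : ℕ} {p : Fin d → ℝ} {u : ℝ} (h : ∀ i, p i = 0 ∨ p i = u)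
    (n : ℕ) (x : Fin n → Fin d) : tpow p n x = 0 ∨ tpow p n x = u ^ n := by
  by_cases hx : ∃ j, p (x j) = 0
  · obtain ⟨j, hj⟩ := hx
    exact Or.inl (prod_eq_zero (mem_univ j) hj)
  · push Not at hx
    right
    simp [tpow, fun j => (h (x j)).resolve_left (hx j)]

lemma tensor_tpow_flat {d k : ℕ} {p : Fin d → ℝ} {s : Fin k → ℝ} (hp : IsProbDist p)
    (hV : entV p = 0) (hs : IsSharp s) (n m : ℕ) (x : (Fin n → Fin d) × (Fin m → Fin k)) :
    tensor (tpow p n) (tpow s m) x = 0 ∨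
      tensor (tpow p n) (tpow s m) x = Real.exp (-(n * shannonH p)) := by
  have h1 := tpow_eq_zero_or_eq_pow (eq_zero_or_eq_exp_of_entV_eq_zero hp hV) n x.1
  have h2 : ∀ i, s i = 0 ∨ s i = 1 := by
    obtain ⟨i, hi, hj⟩ := hs
    intro j
    by_cases hji : j = i
    · exact Or.inr (hji ▸ hi)
    · exact Or.inl (hj j hji)
  have h3 := tpow_eq_zero_or_eq_pow h2 m x.2
  rw [← Real.exp_nat_mul, mul_neg] at h1
  rw [one_pow] at h3
  unfold tensor
  rcases h1 with h1 | h1 <;> rcases h3 with h3 | h3 <;> simp [h1, h3]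

/-- Approximate majorisation of `q^{⊗m}` over a flat distribution amounts to a set of at most
`exp (n H(p))` outcomes that carries all but `e` of the mass of `q^{⊗m}`. -/
lemma approxSubMajTV_iff_exists_finset {dp dq ds : ℕ} {p : Fin dp → ℝ} {q : Fin dq → ℝ}
    {s : Fin ds → ℝ} (hp : IsProbDist p) (hq : IsProbDist q) (hs : IsProbDist s)
    (hsharp : IsSharp s) (hVp : entV p = 0) (n m : ℕ) {e : ℝ} (he : e < 1) :
    ApproxSubMajTV (tensor (tpow p n) (tpow s m)) (tensor (tpow q m) (tpow s n)) e ↔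
      ∃ A : Finset (Fin m → Fin dq), (A.card : ℝ) * Real.exp (-(n * shannonH p)) ≤ 1 ∧
        1 - e ≤ ∑ x ∈ A, tpow q m x := by
  classical
  have ha := isProbDist_tensor (isProbDist_tpow hp n) (isProbDist_tpow hs m)
  have hb := isProbDist_tensor (isProbDist_tpow hq m) (isProbDist_tpow hs n)
  have hflat := tensor_tpow_flat hp hVp hsharp n m
  constructor
  · intro h
    obtain ⟨B, hB, hBs⟩ := exists_finset_of_approxSubMajTV ha hflat hb h
    refine ⟨B.image Prod.fst, ?_, hBs.trans
      (sum_tensor_le_sum_image_fst (isProbDist_tpow hq m).1 (isProbDist_tpow hs n) B)⟩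
    refine le_trans ?_ hB
    gcongr
    exact card_image_le
  · rintro ⟨A, hA, hAs⟩
    obtain ⟨i, hi, -⟩ := hsharp
    have hone : tpow s n (fun _ => i) = 1 := by simp [tpow, hi]
    have hsum : ∑ x ∈ A ×ˢ {fun _ : Fin n => i}, tensor (tpow q m) (tpow s n) x
        = ∑ x ∈ A, tpow q m x := by
      rw [sum_product]
      simp [tensor, hone]
    refine approxSubMajTV_of_finset ha (Real.exp_pos _).le (fun x => ?_) hb
      (A ×ˢ {fun _ : Fin n => i}) ?_ (by simpa using hA) (hsum ▸ hAs)
    · rcases hflat x with h | h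
      · exact h ▸ (Real.exp_pos _).le
      · exact h.le
    · by_contra hne
      rw [not_nonempty_iff_eq_empty] at hne
      rw [hne, sum_empty] at hsum
      linarith

section ModerateDeviations

variable {d : ℕ} {q Y : Fin d → ℝ} {V : ℝ}

lemma sum_tpow_mul_exp (q Y : Fin d → ℝ) (θ : ℝ) (m : ℕ) :
    ∑ x, tpow q m x * Real.exp (θ * ∑ j, Y (x j))
      = (∑ i, q i * Real.exp (θ * Y i)) ^ m := by
  rw [Fintype.sum_pow]
  refine sum_congr rfl fun x _ => ?_
  rw [mul_sum, Real.exp_sum, tpow, prod_mul_distrib]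

/-- Exponential Markov inequality for tilted sums. -/
lemma sum_filter_tpow_mul_exp_le (hq : IsProbDist q) (θ l b : ℝ) (m : ℕ)
    (P : (Fin m → Fin d) → Prop) [DecidablePred P] (hP : ∀ x, P x → l * b ≤ l * ∑ j, Y (x j)) :
    ∑ x with P x, tpow q m x * Real.exp (θ * ∑ j, Y (x j))
      ≤ Real.exp (-(l * b)) * (∑ i, q i * Real.exp ((θ + l) * Y i)) ^ m := by
  rw [← sum_tpow_mul_exp, mul_sum]
  have hQ := (isProbDist_tpow hq m).1
  refine le_trans (sum_le_sum fun x hx => ?_) (sum_le_sum_of_subset_of_nonneg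
    (filter_subset P univ) fun x _ _ => mul_nonneg (Real.exp_pos _).le
      (mul_nonneg (hQ x) (Real.exp_pos _).le))
  have h := hP x (mem_filter.mp hx).2
  rw [mul_left_comm, ← Real.exp_add]
  refine mul_le_mul_of_nonneg_left (Real.exp_le_exp.mpr ?_) (hQ x)
  rw [add_mul]
  linarith

lemma abs_exp_sub_quadratic_le {y : ℝ} (hy : |y| ≤ 1) :
    |Real.exp y - (1 + y + y ^ 2 / 2)| ≤ |y| ^ 3 := by
  have h := Real.exp_bound hy (n := 3) (by norm_num)
  simp only [sum_range_succ, range_zero, sum_empty, Nat.factorial] at h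
  norm_num at h
  have h3 : 0 ≤ |y| ^ 3 := by positivity
  linarith

lemma eventually_exp_le_mgf_le (hq : IsProbDist q) (hY : ∑ i, q i * Y i = 0)
    (hV : ∑ i, q i * Y i ^ 2 = V) {δ : ℝ} (hδ : 0 < δ) :
    ∀ᶠ θ in 𝓝 (0 : ℝ), Real.exp (θ ^ 2 * (V / 2 - δ)) ≤ ∑ i, q i * Real.exp (θ * Y i) ∧
      ∑ i, q i * Real.exp (θ * Y i) ≤ Real.exp (θ ^ 2 * (V / 2 + δ)) := by
  set B := ∑ i, |Y i| with hB
  have hYB : ∀ i, |Y i| ≤ B := fun i =>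
    single_le_sum (f := fun i => |Y i|) (fun i _ => abs_nonneg _) (mem_univ i)
  have hB0 : 0 ≤ B := sum_nonneg fun i _ => abs_nonneg _
  have small : ∀ f : ℝ → ℝ, Continuous f → f 0 = 0 → ∀ r : ℝ, 0 < r →
      ∀ᶠ θ in 𝓝 (0 : ℝ), f θ < r := fun f hf h0 r hr =>
    hf.continuousAt.eventually_lt_const (by rwa [h0])
  filter_upwards [small (fun θ => |θ| * B) (by fun_prop) (by simp) 1 one_pos,
    small (fun θ => |θ| * B ^ 3) (by fun_prop) (by simp) (δ / 2) (by positivity),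
    small (fun θ => |θ ^ 2 * (V / 2 - δ)|) (by fun_prop) (by simp) 1 one_pos,
    small (fun θ => θ ^ 2 * (V / 2 - δ) ^ 2) (by fun_prop) (by simp) (δ / 2) (by positivity)]
    with θ h1 h2 h3 h4
  have key : |∑ i, q i * Real.exp (θ * Y i) - (1 + θ ^ 2 * V / 2)| ≤ θ ^ 2 * (δ / 2) := by
    have e1 : ∑ i, q i * Real.exp (θ * Y i) - (1 + θ ^ 2 * V / 2)
        = ∑ i, q i * (Real.exp (θ * Y i) - (1 + θ * Y i + (θ * Y i) ^ 2 / 2)) := by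
      have : ∀ i, q i * (Real.exp (θ * Y i) - (1 + θ * Y i + (θ * Y i) ^ 2 / 2))
          = q i * Real.exp (θ * Y i) - (q i + θ * (q i * Y i) + θ ^ 2 / 2 * (q i * Y i ^ 2)) :=
        fun i => by ring
      simp only [this]
      rw [sum_sub_distrib, sum_add_distrib, sum_add_distrib, ← mul_sum, ← mul_sum, hY, hV, hq.2]
      ring
    rw [e1]
    calc _ ≤ ∑ i, q i * (θ ^ 2 * (δ / 2)) := by
          refine (abs_sum_le_sum_abs _ _).trans (sum_le_sum fun i _ => ?_)
          rw [abs_mul, abs_of_nonneg (hq.1 i)]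
          refine mul_le_mul_of_nonneg_left ?_ (hq.1 i)
          have hle : |θ * Y i| ≤ |θ| * B := by
            rw [abs_mul]; exact mul_le_mul_of_nonneg_left (hYB i) (abs_nonneg _)
          refine (abs_exp_sub_quadratic_le (hle.trans h1.le)).trans ?_
          calc |θ * Y i| ^ 3 ≤ (|θ| * B) ^ 3 := by gcongr
            _ = |θ| ^ 2 * (|θ| * B ^ 3) := by ring
            _ ≤ |θ| ^ 2 * (δ / 2) := by gcongr
            _ = θ ^ 2 * (δ / 2) := by rw [sq_abs]
      _ = θ ^ 2 * (δ / 2) := by rw [← sum_mul, hq.2, one_mul]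
  rw [abs_le] at key
  have hθ := sq_nonneg θ
  constructor
  · have h5 := Real.abs_exp_sub_one_sub_id_le h3.le
    rw [abs_le] at h5
    nlinarith [mul_le_mul_of_nonneg_left h4.le hθ]
  · have h5 := Real.add_one_le_exp (θ ^ 2 * (V / 2 + δ))
    nlinarith [mul_nonneg hθ hδ.le]

lemma tendsto_mul_right_nhdsGT_zero (c : ℝ) :
    Tendsto (fun x : ℝ => c * x) (𝓝[>] 0) (𝓝 0) := by
  have : Tendsto (fun x : ℝ => c * x) (𝓝 0) (𝓝 (c * 0)) := (continuous_const_mul c).tendsto 0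
  rw [mul_zero] at this
  exact this.mono_left nhdsWithin_le_nhds

lemma eventually_moderate_upper (hq : IsProbDist q) (hY : ∑ i, q i * Y i = 0)
    (hV : ∑ i, q i * Y i ^ 2 = V) (hV0 : 0 < V) {η : ℝ} (hη : 0 < η) :
    ∀ᶠ y in 𝓝[>] (0 : ℝ), ∀ m : ℕ,
      ∑ x : Fin m → Fin d with m * y ≤ ∑ j, Y (x j), tpow q m x
        ≤ Real.exp (-((1 - η) * (m * y ^ 2 / (2 * V)))) := by
  have hM := (tendsto_mul_right_nhdsGT_zero V⁻¹).eventually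
    (eventually_exp_le_mgf_le hq hY hV (δ := η * V / 2) (by positivity))
  filter_upwards [hM, self_mem_nhdsWithin] with y hy hy0 m
  rw [Set.mem_Ioi] at hy0
  have h1 := sum_filter_tpow_mul_exp_le (Y := Y) hq 0 (V⁻¹ * y) (m * y) m
    (fun x => m * y ≤ ∑ j, Y (x j)) fun x hx => mul_le_mul_of_nonneg_left hx (by positivity)
  simp only [zero_mul, Real.exp_zero, mul_one, zero_add] at h1
  refine h1.trans ?_
  calc _ ≤ Real.exp (-(V⁻¹ * y * (m * y)))
        * Real.exp ((V⁻¹ * y) ^ 2 * (V / 2 + η * V / 2)) ^ m := by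
        gcongr
        · exact sum_nonneg fun i _ => mul_nonneg (hq.1 i) (Real.exp_pos _).le
        · exact hy.2
    _ = _ := by
        rw [← Real.exp_nat_mul, ← Real.exp_add]
        congr 1
        field_simp
        ring

set_option maxHeartbeats 1000000 in
lemma exists_moderate_lower (hq : IsProbDist q) (hY : ∑ i, q i * Y i = 0)
    (hV : ∑ i, q i * Y i ^ 2 = V) (hV0 : 0 < V) {η : ℝ} (hη : 0 < η) :
    ∃ L : ℝ, ∀ᶠ y in 𝓝[>] (0 : ℝ), ∀ m : ℕ, L ≤ m * y ^ 2 →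
      Real.exp (-((1 + η) * (m * y ^ 2 / (2 * V))))
        ≤ ∑ x : Fin m → Fin d with m * y < ∑ j, Y (x j), tpow q m x := by
  obtain ⟨h, h0, h1, hη'⟩ : ∃ h : ℝ, 0 < h ∧ h ≤ 1 ∧ 10 * h ≤ η :=
    ⟨min 1 (η / 10), by positivity, min_le_left _ _, by linarith [min_le_right 1 (η / 10)]⟩
  set δ := h ^ 2 / 52 * V with hδ
  have hδ0 : 0 < δ := by positivity
  have hM := eventually_exp_le_mgf_le hq hY hV hδ0
  refine ⟨8 * V / h ^ 2, ?_⟩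
  filter_upwards [(tendsto_mul_right_nhdsGT_zero V⁻¹).eventually hM,
    (tendsto_mul_right_nhdsGT_zero ((1 + h) * V⁻¹)).eventually hM,
    (tendsto_mul_right_nhdsGT_zero ((1 + 2 * h) * V⁻¹)).eventually hM,
    self_mem_nhdsWithin] with y hy1 hy2 hy3 hy0 m hm
  rw [Set.mem_Ioi] at hy0
  set M : ℝ → ℝ := fun θ => ∑ i, q i * Real.exp (θ * Y i) with hMdef
  have hMnn : ∀ θ, 0 ≤ M θ := fun θ =>
    sum_nonneg fun i _ => mul_nonneg (hq.1 i) (Real.exp_pos _).le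
  set w := m * y ^ 2 / V with hw
  have hw1 : 8 ≤ w * h ^ 2 := by
    rw [div_le_iff₀ (by positivity)] at hm
    rw [hw, div_mul_eq_mul_div, le_div_iff₀ hV0]
    exact hm
  have hw0 : 0 ≤ w := by positivity
  set θ := (1 + h) * V⁻¹ * y with hθ
  set l := h * V⁻¹ * y with hl
  have hθ0 : 0 < θ := by positivity
  have hl0 : 0 < l := by positivity
  have hQ := (isProbDist_tpow hq m).1
  have hmid : Real.exp (w * ((1 + h) ^ 2 * (1 / 2 - h ^ 2 / 52))) ≤ M θ ^ m := by
    calc _ = Real.exp (θ ^ 2 * (V / 2 - δ)) ^ m := by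
          rw [← Real.exp_nat_mul]
          congr 1
          rw [hθ, hδ, hw]
          field_simp
      _ ≤ M θ ^ m := by gcongr; exact hy2.1
  have hlow : ∑ x : Fin m → Fin d with ∑ j, Y (x j) ≤ m * y,
      tpow q m x * Real.exp (θ * ∑ j, Y (x j))
        ≤ Real.exp (w * (h + 1 / 2 + h ^ 2 / 52)) := by
    refine (sum_filter_tpow_mul_exp_le hq θ (-l) (m * y) m _ fun x hx => ?_).trans ?_
    · nlinarith
    · calc _ ≤ Real.exp (-(-l * (m * y))) * Real.exp ((V⁻¹ * y) ^ 2 * (V / 2 + δ)) ^ m := by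
            have e : θ + -l = V⁻¹ * y := by rw [hθ, hl]; ring
            rw [e]
            gcongr
            · exact hMnn _
            · exact hy1.2
        _ = _ := by
            rw [← Real.exp_nat_mul, ← Real.exp_add]
            congr 1
            rw [hl, hδ, hw]
            field_simp
            ring
  have hhigh : ∑ x : Fin m → Fin d with m * ((1 + 2 * h) * y) ≤ ∑ j, Y (x j),
      tpow q m x * Real.exp (θ * ∑ j, Y (x j))
        ≤ Real.exp (w * (-(h * (1 + 2 * h)) + (1 + 2 * h) ^ 2 * (1 / 2 + h ^ 2 / 52))) := by
    refine (sum_filter_tpow_mul_exp_le hq θ l (m * ((1 + 2 * h) * y)) m _ fun x hx => ?_).trans ?_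
    · exact mul_le_mul_of_nonneg_left hx hl0.le
    · calc _ ≤ Real.exp (-(l * (m * ((1 + 2 * h) * y))))
            * Real.exp (((1 + 2 * h) * V⁻¹ * y) ^ 2 * (V / 2 + δ)) ^ m := by
            have e : θ + l = (1 + 2 * h) * V⁻¹ * y := by rw [hθ, hl]; ring
            rw [e]
            gcongr
            · exact hMnn _
            · exact hy3.2
        _ = _ := by
            rw [← Real.exp_nat_mul, ← Real.exp_add]
            congr 1
            rw [hl, hδ, hw]
            field_simp
  have hquarter : Real.exp (-2) ≤ 1 / 4 := by
    have h1 := Real.add_one_le_exp (1 : ℝ)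
    have h2 : Real.exp 2 = Real.exp 1 * Real.exp 1 := by rw [← Real.exp_add]; norm_num
    rw [Real.exp_neg, ← one_div]
    apply one_div_le_one_div_of_le (by norm_num)
    rw [h2]
    nlinarith
  have hpoly1 : h + 1 / 2 + h ^ 2 / 52 + h ^ 2 / 4 ≤ (1 + h) ^ 2 * (1 / 2 - h ^ 2 / 52) := by
    have h2 : 0 ≤ 11 - 2 * h - h ^ 2 := by nlinarith
    linarith [mul_nonneg (sq_nonneg h) h2]
  have hpoly2 : -(h * (1 + 2 * h)) + (1 + 2 * h) ^ 2 * (1 / 2 + h ^ 2 / 52) + h ^ 2 / 4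
      ≤ (1 + h) ^ 2 * (1 / 2 - h ^ 2 / 52) := by
    have h2 : 0 ≤ 11 - 6 * h - 5 * h ^ 2 := by nlinarith
    linarith [mul_nonneg (sq_nonneg h) h2]
  have hpoly3 : -(1 + η) / 2 + (1 + h) * (1 + 2 * h)
      ≤ -h + (1 + h) ^ 2 * (1 / 2 - h ^ 2 / 52) := by
    have h2 : (1 + h) ^ 2 ≤ 4 := by nlinarith
    have h3 : 0 ≤ 2 - 3 / 2 * h - (1 + h) ^ 2 * h / 52 := by
      nlinarith [mul_le_mul_of_nonneg_right h2 h0.le]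
    linarith [mul_nonneg h0.le h3]
  have hbound : ∀ v, v + h ^ 2 / 4 ≤ (1 + h) ^ 2 * (1 / 2 - h ^ 2 / 52) →
      Real.exp (w * v) ≤ 1 / 4 * M θ ^ m := by
    intro v hv
    calc Real.exp (w * v)
        ≤ Real.exp (-2 + w * ((1 + h) ^ 2 * (1 / 2 - h ^ 2 / 52))) := by
          apply Real.exp_le_exp.mpr
          linarith [mul_le_mul_of_nonneg_left hv hw0]
      _ = Real.exp (-2) * Real.exp (w * ((1 + h) ^ 2 * (1 / 2 - h ^ 2 / 52))) := Real.exp_add _ _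
      _ ≤ 1 / 4 * M θ ^ m := by gcongr
  have hlow' := hlow.trans (hbound _ hpoly1)
  have hhigh' := hhigh.trans (hbound _ hpoly2)
  have htail : ∑ x : Fin m → Fin d with
      (¬ ∑ j, Y (x j) ≤ m * y) ∧ ¬ m * ((1 + 2 * h) * y) ≤ ∑ j, Y (x j),
      tpow q m x * Real.exp (θ * ∑ j, Y (x j))
        ≤ (∑ x : Fin m → Fin d with m * y < ∑ j, Y (x j), tpow q m x)
          * Real.exp (θ * (m * ((1 + 2 * h) * y))) := by
    rw [sum_mul]
    refine le_trans (sum_le_sum fun x hx => ?_) (sum_le_sum_of_subset_of_nonneg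
      (fun x hx => ?_) fun x _ _ => mul_nonneg (hQ x) (Real.exp_pos _).le)
    · have := (mem_filter.mp hx).2.2
      refine mul_le_mul_of_nonneg_left (Real.exp_le_exp.mpr ?_) (hQ x)
      exact mul_le_mul_of_nonneg_left (not_le.mp this).le hθ0.le
    · have := (mem_filter.mp hx).2.1
      exact mem_filter.mpr ⟨mem_univ _, not_le.mp this⟩
  set T := ∑ x : Fin m → Fin d with m * y < ∑ j, Y (x j), tpow q m x
  have hsplit : M θ ^ m ≤ 1 / 4 * M θ ^ m
      + (1 / 4 * M θ ^ m + T * Real.exp (θ * (m * ((1 + 2 * h) * y)))) := by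
    calc M θ ^ m = ∑ x, tpow q m x * Real.exp (θ * ∑ j, Y (x j)) :=
          (sum_tpow_mul_exp q Y θ m).symm
      _ = _ := (sum_filter_add_sum_filter_not univ (fun x => ∑ j, Y (x j) ≤ m * y) _).symm
      _ ≤ 1 / 4 * M θ ^ m
          + (1 / 4 * M θ ^ m + T * Real.exp (θ * (m * ((1 + 2 * h) * y)))) := by
          refine add_le_add hlow' ?_
          rw [← sum_filter_add_sum_filter_not (univ.filter fun x : Fin m → Fin d =>
            ¬ ∑ j, Y (x j) ≤ m * y) (fun x => m * ((1 + 2 * h) * y) ≤ ∑ j, Y (x j)),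
            filter_filter, filter_filter]
          refine add_le_add (le_trans ?_ hhigh') htail
          refine sum_le_sum_of_subset_of_nonneg (fun x hx => ?_)
            fun x _ _ => mul_nonneg (hQ x) (Real.exp_pos _).le
          simp only [mem_filter, mem_univ, true_and] at hx ⊢
          exact hx.2
  have hT : 1 / 2 * M θ ^ m ≤ T * Real.exp (θ * (m * ((1 + 2 * h) * y))) := by linarith
  have hθe : θ * (m * ((1 + 2 * h) * y)) = w * ((1 + h) * (1 + 2 * h)) := by
    rw [hθ, hw]
    field_simp
  rw [hθe] at hT
  have hhalf : Real.exp (-(w * h)) ≤ 1 / 2 := by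
    have h2 : 1 ≤ w * h := by nlinarith
    have h3 := Real.add_one_le_exp (w * h)
    rw [Real.exp_neg, ← one_div]
    exact one_div_le_one_div_of_le (by norm_num) (by linarith)
  have hfin : Real.exp (-((1 + η) * (m * y ^ 2 / (2 * V))))
      * Real.exp (w * ((1 + h) * (1 + 2 * h)))
        ≤ 1 / 2 * Real.exp (w * ((1 + h) ^ 2 * (1 / 2 - h ^ 2 / 52))) := by
    refine le_trans ?_ (mul_le_mul_of_nonneg_right hhalf (Real.exp_pos _).le)
    rw [← Real.exp_add, ← Real.exp_add]
    apply Real.exp_le_exp.mpr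
    have e : m * y ^ 2 / (2 * V) = w / 2 := by rw [hw]; field_simp
    rw [e]
    linarith [mul_le_mul_of_nonneg_left hpoly3 hw0]
  refine le_of_mul_le_mul_right (hfin.trans (le_trans ?_ hT)) (Real.exp_pos _)
  gcongr

end ModerateDeviations

lemma tpow_eq_exp_of_ne_zero {d : ℕ} {q : Fin d → ℝ} (hq : IsProbDist q) {m : ℕ}
    {x : Fin m → Fin d} (hx : tpow q m x ≠ 0) (H : ℝ) :
    tpow q m x = Real.exp (-(∑ j, (-Real.log (q (x j)) - H) + m * H)) := by
  have hpos : ∀ j, 0 < q (x j) := fun j =>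
    (hq.1 _).lt_of_ne' (prod_ne_zero_iff.mp hx j (mem_univ j))
  have h1 : -(∑ j, (-Real.log (q (x j)) - H) + m * H) = ∑ j, Real.log (q (x j)) := by
    rw [sum_sub_distrib, sum_neg_distrib]
    simp
  rw [h1, Real.exp_sum]
  exact prod_congr rfl fun j _ => (Real.exp_log (hpos j)).symm

lemma exists_finset_of_tail_le {d : ℕ} {q : Fin d → ℝ} (hq : IsProbDist q) {m : ℕ}
    {H L y e : ℝ} (hL : m * H + m * y ≤ L)
    (htail : ∑ x : Fin m → Fin d with m * y ≤ ∑ j, (-Real.log (q (x j)) - H), tpow q m x ≤ e) :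
    ∃ A : Finset (Fin m → Fin d), (A.card : ℝ) * Real.exp (-L) ≤ 1 ∧
      1 - e ≤ ∑ x ∈ A, tpow q m x := by
  have hQ := isProbDist_tpow hq m
  refine ⟨univ.filter fun x => Real.exp (-L) ≤ tpow q m x, ?_, ?_⟩
  · rw [← hQ.2, ← nsmul_eq_mul]
    exact (card_nsmul_le_sum _ _ _ fun x hx => (mem_filter.mp hx).2).trans
      (sum_le_sum_of_subset_of_nonneg (filter_subset _ _) fun x _ _ => hQ.1 x)
  · have h1 := sum_filter_add_sum_filter_not univ
      (fun x => Real.exp (-L) ≤ tpow q m x) (tpow q m)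
    rw [hQ.2] at h1
    have h2 : ∑ x with ¬ Real.exp (-L) ≤ tpow q m x, tpow q m x ≤ e := by
      rw [← sum_filter_ne_zero, filter_filter]
      refine le_trans (sum_le_sum_of_subset_of_nonneg (fun x hx => ?_)
        fun x _ _ => hQ.1 x) htail
      simp only [mem_filter, mem_univ, true_and, not_le] at hx ⊢
      obtain ⟨hx1, hx2⟩ := hx
      rw [tpow_eq_exp_of_ne_zero hq hx2 H, Real.exp_lt_exp] at hx1
      linarith
    linarith

lemma tail_le_of_exists_finset {d : ℕ} {q : Fin d → ℝ} (hq : IsProbDist q) {m : ℕ}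
    {H L δ y e : ℝ} (hL : L + δ ≤ m * H + m * y)
    (h : ∃ A : Finset (Fin m → Fin d), (A.card : ℝ) * Real.exp (-L) ≤ 1 ∧
      1 - e ≤ ∑ x ∈ A, tpow q m x) :
    ∑ x : Fin m → Fin d with m * y < ∑ j, (-Real.log (q (x j)) - H), tpow q m x
      ≤ e + Real.exp (-δ) := by
  classical
  obtain ⟨A, hA, hAs⟩ := h
  have hQ := isProbDist_tpow hq m
  set P : (Fin m → Fin d) → Prop := fun x => m * y < ∑ j, (-Real.log (q (x j)) - H)
  have h1 := sum_filter_add_sum_filter_not univ P (tpow q m)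
  rw [hQ.2] at h1
  have h2 := sum_filter_add_sum_filter_not A P (tpow q m)
  have h3 : ∑ x ∈ A with ¬ P x, tpow q m x ≤ ∑ x with ¬ P x, tpow q m x :=
    sum_le_sum_of_subset_of_nonneg (filter_subset_filter _ (subset_univ _)) fun x _ _ => hQ.1 x
  have h4 : ∑ x ∈ A with P x, tpow q m x ≤ Real.exp (-δ) := by
    calc _ ≤ (A.filter P).card • (Real.exp (-L) * Real.exp (-δ)) := by
          refine sum_le_card_nsmul _ _ _ fun x hx => ?_
          by_cases hx0 : tpow q m x = 0
          · rw [hx0]; positivity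
          · have hx' : m * y < ∑ j, (-Real.log (q (x j)) - H) := (mem_filter.mp hx).2
            rw [tpow_eq_exp_of_ne_zero hq hx0 H, ← Real.exp_add, Real.exp_le_exp]
            linarith
      _ ≤ A.card * (Real.exp (-L) * Real.exp (-δ)) := by
          rw [nsmul_eq_mul]
          gcongr
          exact filter_subset _ _
      _ = A.card * Real.exp (-L) * Real.exp (-δ) := (mul_assoc _ _ _).symm
      _ ≤ 1 * Real.exp (-δ) := by gcongr
      _ = Real.exp (-δ) := one_mul _
  linarith

lemma sum_mul_neg_log_sub_shannonH {d : ℕ} {q : Fin d → ℝ} (hq : IsProbDist q) :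
    ∑ i, q i * (-Real.log (q i) - shannonH q) = 0 := by
  have : ∀ i, q i * (-Real.log (q i) - shannonH q)
      = -(q i * Real.log (q i)) - q i * shannonH q := fun i => by ring
  simp only [this]
  rw [sum_sub_distrib, sum_neg_distrib, ← sum_mul, hq.2, one_mul]
  simp [shannonH]

lemma sum_mul_neg_log_sub_shannonH_sq {d : ℕ} (q : Fin d → ℝ) :
    ∑ i, q i * (-Real.log (q i) - shannonH q) ^ 2 = entV q :=
  sum_congr rfl fun i _ => by ring

lemma ModerateSeq.tendsto_nat_mul_sq {t : ℕ → ℝ} (ht : ModerateSeq t) :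
    Tendsto (fun n : ℕ => (n : ℝ) * t n ^ 2) atTop atTop := by
  have := (tendsto_pow_atTop two_ne_zero).comp ht.2
  refine this.congr fun n => ?_
  simp only [Function.comp, mul_pow]
  rw [Real.sq_sqrt (Nat.cast_nonneg n)]

lemma ModerateSeq.tendsto_nat_mul {t : ℕ → ℝ} (ht : ModerateSeq t) :
    Tendsto (fun n : ℕ => (n : ℝ) * t n) atTop atTop := by
  have := (Real.tendsto_sqrt_atTop.comp tendsto_natCast_atTop_atTop).atTop_mul_atTop₀ ht.2
  refine this.congr fun n => ?_
  simp only [Function.comp]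
  rw [← mul_assoc, Real.mul_self_sqrt (Nat.cast_nonneg n)]

lemma ModerateSeq.eventually_pos {t : ℕ → ℝ} (ht : ModerateSeq t) : ∀ᶠ n in atTop, 0 < t n := by
  filter_upwards [ht.2.eventually_gt_atTop 0] with n hn
  exact pos_of_mul_pos_right hn (Real.sqrt_nonneg _)

lemma eventually_exists_finset {d : ℕ} {q : Fin d → ℝ} (hq : IsProbDist q)
    (hH : 0 < shannonH q) (hV : 0 < entV q) {t : ℕ → ℝ} (ht : ModerateSeq t) {a c : ℝ}
    (ha : 0 < a) (hc : 0 < c) (hlt : 2 * entV q * a < c ^ 2 * shannonH q ^ 3) :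
    ∀ᶠ n : ℕ in atTop, ∃ A : Finset (Fin ⌊n * (a / shannonH q - c * t n)⌋₊ → Fin d),
      (A.card : ℝ) * Real.exp (-(n * a)) ≤ 1 ∧
        1 - Real.exp (-(n * t n ^ 2)) ≤ ∑ x ∈ A, tpow q _ x := by
  set H := shannonH q with hHdef
  set V := entV q
  set r := 2 * V * a / (c ^ 2 * H ^ 3) with hr
  have hr0 : 0 < r := by positivity
  have hr1 : r < 1 := (div_lt_one (by positivity)).mpr hlt
  have hMD := eventually_moderate_upper hq (sum_mul_neg_log_sub_shannonH hq)
    (sum_mul_neg_log_sub_shannonH_sq q) hV (sub_pos.mpr hr1)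
  set m : ℕ → ℕ := fun n => ⌊n * (a / H - c * t n)⌋₊ with hm
  set y : ℕ → ℝ := fun n => n * (H * c * t n) / m n with hy
  have hmlow : ∀ᶠ n : ℕ in atTop, n * (a / (2 * H)) ≤ m n := by
    have h1 : ∀ᶠ n in atTop, c * t n < a / (4 * H) := by
      have := ht.1.const_mul c
      rw [mul_zero] at this
      exact this.eventually_lt_const (by positivity)
    filter_upwards [h1, tendsto_natCast_atTop_atTop.eventually_ge_atTop (4 * H / a)] with n h1 h2
    have h3 := Nat.lt_floor_add_one (n * (a / H - c * t n))
    have h4 : 1 ≤ n * (a / (4 * H)) := by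
      rw [div_le_iff₀ ha] at h2
      rw [← mul_div_assoc, le_div_iff₀ (by positivity)]
      linarith
    have h5 : (n : ℝ) * (c * t n) ≤ n * (a / (4 * H)) := by gcongr
    have h6 : a / H = a / (2 * H) + a / (4 * H) + a / (4 * H) := by field_simp; norm_num
    have h7 : (n : ℝ) * (a / H) = n * (a / (2 * H)) + n * (a / (4 * H)) + n * (a / (4 * H)) := by
      rw [h6]; ring
    have h8 : (n : ℝ) * (a / H - c * t n) = n * (a / H) - n * (c * t n) := by ring
    simp only [hm]
    linarith
  have hbase : ∀ᶠ n : ℕ in atTop, 0 < (n : ℝ) ∧ 0 < t n ∧ 0 < (m n : ℝ) := by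
    filter_upwards [hmlow, ht.eventually_pos, eventually_gt_atTop 0] with n h1 h2 h3
    have h4 : (0 : ℝ) < n := by exact_mod_cast h3
    exact ⟨h4, h2, lt_of_lt_of_le (by positivity) h1⟩
  have hy0 : Tendsto y atTop (𝓝[>] 0) := by
    refine tendsto_nhdsWithin_iff.mpr ⟨?_, ?_⟩
    · have hz : Tendsto (fun n => 2 * H ^ 2 * c / a * t n) atTop (𝓝 0) := by
        simpa using ht.1.const_mul (2 * H ^ 2 * c / a)
      refine tendsto_of_tendsto_of_tendsto_of_le_of_le' tendsto_const_nhds hz ?_ ?_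
      · filter_upwards [hbase] with n ⟨h1, h2, h3⟩
        positivity
      · filter_upwards [hbase, hmlow] with n ⟨h1, h2, h3⟩ h4
        simp only [hy]
        rw [div_le_iff₀ h3]
        calc (n : ℝ) * (H * c * t n) = 2 * H ^ 2 * c / a * t n * (n * (a / (2 * H))) := by
              field_simp
          _ ≤ _ := by gcongr
    · filter_upwards [hbase] with n ⟨h1, h2, h3⟩
      exact Set.mem_Ioi.mpr (by positivity)
  filter_upwards [hbase, hy0.eventually hMD] with n ⟨h1, h2, h3⟩ h4
  have hmy : m n * y n = n * (H * c * t n) := by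
    simp only [hy]
    field_simp
  have hmpos : 0 ≤ (n : ℝ) * (a / H - c * t n) := by
    by_contra hneg
    have : m n = 0 := Nat.floor_of_nonpos (not_le.mp hneg).le
    rw [this] at h3
    simp at h3
  have hmup : (m n : ℝ) ≤ n * (a / H - c * t n) := Nat.floor_le hmpos
  refine exists_finset_of_tail_le hq (H := H) (y := y n) ?_ ((h4 (m n)).trans ?_)
  · change m n * H + m n * y n ≤ n * a
    rw [hmy]
    have := mul_le_mul_of_nonneg_right hmup hH.le
    have e : (n : ℝ) * (a / H - c * t n) * H = n * a - n * (H * c * t n) := by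
      field_simp
    linarith
  · apply Real.exp_le_exp.mpr
    rw [neg_le_neg_iff, sub_sub_cancel]
    have hmup' : (m n : ℝ) ≤ n * (a / H) := hmup.trans (by gcongr; linarith [mul_pos hc h2])
    have e1 : m n * y n ^ 2 = (n * (H * c * t n)) ^ 2 / m n := by
      simp only [hy]
      field_simp
    rw [e1]
    calc (n : ℝ) * t n ^ 2
        = r * ((n * (H * c * t n)) ^ 2 / (n * (a / H)) / (2 * V)) := by
          rw [hr]
          field_simp
      _ ≤ _ := by gcongr

lemma eventually_not_exists_finset {d : ℕ} {q : Fin d → ℝ} (hq : IsProbDist q)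
    (hH : 0 < shannonH q) (hV : 0 < entV q) {t : ℕ → ℝ} (ht : ModerateSeq t) {a c : ℝ}
    (ha : 0 < a) (hc : 0 < c) (hlt : c ^ 2 * shannonH q ^ 3 < 2 * entV q * a) :
    ∀ᶠ n : ℕ in atTop, ¬ ∃ A : Finset (Fin ⌈n * (a / shannonH q - c * t n)⌉₊ → Fin d),
      (A.card : ℝ) * Real.exp (-(n * a)) ≤ 1 ∧
        1 - Real.exp (-(n * t n ^ 2)) ≤ ∑ x ∈ A, tpow q _ x := by
  set H := shannonH q with hHdef
  set V := entV q
  set r := c ^ 2 * H ^ 3 / (2 * V * a) with hr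
  have hr0 : 0 < r := by positivity
  have hr1 : r < 1 := (div_lt_one (by positivity)).mpr hlt
  set η := (1 - r) / (2 * r) with hη
  have hη0 : 0 < η := div_pos (by linarith) (by linarith)
  obtain ⟨L, hMD⟩ := exists_moderate_lower hq (sum_mul_neg_log_sub_shannonH hq)
    (sum_mul_neg_log_sub_shannonH_sq q) hV hη0
  set m : ℕ → ℕ := fun n => ⌈n * (a / H - c * t n)⌉₊ with hm
  set y : ℕ → ℝ := fun n => n * (H * c * t n + 2 * t n ^ 2) / m n with hy
  have hbase : ∀ᶠ n : ℕ in atTop, 0 < (n : ℝ) ∧ 0 < t n ∧ 0 < a / H - c * t n := by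
    have h1 : ∀ᶠ n in atTop, c * t n < a / H := by
      have := ht.1.const_mul c
      rw [mul_zero] at this
      exact this.eventually_lt_const (by positivity)
    filter_upwards [h1, ht.eventually_pos, eventually_gt_atTop 0] with n h1 h2 h3
    exact ⟨by exact_mod_cast h3, h2, by linarith⟩
  have hmlow : ∀ n : ℕ, n * (a / H - c * t n) ≤ m n := fun n => Nat.le_ceil _
  have hmpos : ∀ᶠ n : ℕ in atTop, 0 < (m n : ℝ) := by
    filter_upwards [hbase] with n ⟨h1, h2, h3⟩
    exact lt_of_lt_of_le (by positivity) (hmlow n)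
  have hy0 : Tendsto y atTop (𝓝[>] 0) := by
    refine tendsto_nhdsWithin_iff.mpr ⟨?_, ?_⟩
    · have hz : Tendsto (fun n => (H * c * t n + 2 * t n ^ 2) / (a / H - c * t n)) atTop
          (𝓝 0) := by
        have := ((ht.1.const_mul (H * c)).add ((ht.1.pow 2).const_mul 2)).div
          ((ht.1.const_mul c).const_sub (a / H)) (by simpa using (div_pos ha hH).ne')
        simpa [Pi.div_def] using this
      refine tendsto_of_tendsto_of_tendsto_of_le_of_le' tendsto_const_nhds hz ?_ ?_
      · filter_upwards [hbase] with n ⟨h1, h2, h3⟩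
        positivity
      · filter_upwards [hbase, hmpos] with n ⟨h1, h2, h3⟩ h4
        simp only [hy]
        rw [div_le_div_iff₀ h4 h3]
        nlinarith [mul_le_mul_of_nonneg_left (hmlow n)
          (show 0 ≤ H * c * t n + 2 * t n ^ 2 by positivity)]
    · filter_upwards [hbase, hmpos] with n ⟨h1, h2, h3⟩ h4
      exact Set.mem_Ioi.mpr (by positivity)
  set G : ℕ → ℝ := fun n =>
    (1 + η) * ((H * c + 2 * t n) ^ 2 / (a / H - c * t n) / (2 * V)) with hG
  have hGlim : Tendsto G atTop (𝓝 ((1 + r) / 2)) := by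
    have h1 := ((((ht.1.const_mul 2).const_add (H * c)).pow 2).div
      ((ht.1.const_mul c).const_sub (a / H))
        (by simpa using (div_pos ha hH).ne')).div_const (2 * V) |>.const_mul (1 + η)
    have e : (1 + η) * ((H * c + 2 * 0) ^ 2 / (a / H - c * 0) / (2 * V)) = (1 + r) / 2 := by
      have : (H * c + 2 * 0) ^ 2 / (a / H - c * 0) / (2 * V) = r := by
        rw [hr]
        simp only [mul_zero, add_zero, sub_zero]
        field_simp
      rw [this, hη]
      field_simp
      ring
    rw [e] at h1
    exact h1
  have hu := ht.tendsto_nat_mul_sq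
  filter_upwards [hbase, hmpos, hy0.eventually hMD,
    hGlim.eventually_lt_const (show (1 + r) / 2 < (3 + r) / 4 by linarith),
    hu.eventually_ge_atTop (|L| * (a / H + 1) / (H * c) ^ 2),
    hu.eventually_ge_atTop 0,
    hu.eventually_gt_atTop (4 * Real.log 2 / (1 - r))] with n ⟨h1, h2, h3⟩ h4 h5 h6 h7 h8 h9 hA
  have hmy : m n * y n = n * (H * c * t n + 2 * t n ^ 2) := by
    simp only [hy]
    field_simp
  have e1 : m n * y n ^ 2 = (n * t n ^ 2) * (H * c + 2 * t n) ^ 2 * (n / m n) := by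
    simp only [hy]
    field_simp
  have hn1 : (1 : ℝ) ≤ n := by
    have : 0 < n := by exact_mod_cast h1
    exact_mod_cast this
  have hLle : L ≤ m n * y n ^ 2 := by
    have hmup : (m n : ℝ) ≤ n * (a / H + 1) := by
      have := Nat.ceil_lt_add_one (show 0 ≤ (n : ℝ) * (a / H - c * t n) by positivity)
      have h10 : 0 ≤ (n : ℝ) * (c * t n) := by positivity
      simp only [hm]
      linarith
    rw [e1]
    calc L ≤ |L| := le_abs_self L
      _ = |L| * (a / H + 1) / (H * c) ^ 2 * (H * c) ^ 2 * (n / (n * (a / H + 1))) := by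
          field_simp
      _ ≤ _ := by
          gcongr
          linarith
  have h10 := (h5 (m n) hLle).trans
    (tail_le_of_exists_finset hq (H := H) (δ := 2 * (n * t n ^ 2)) (y := y n) ?_ hA)
  · have h11 : (1 + η) * (m n * y n ^ 2 / (2 * V)) ≤ (3 + r) / 4 * (n * t n ^ 2) := by
      calc _ ≤ (1 + η) * ((n * t n ^ 2) * (H * c + 2 * t n) ^ 2
            * (1 / (a / H - c * t n)) / (2 * V)) := by
            rw [e1]
            gcongr ?_ * (?_ * ?_ / _)
            rw [div_le_div_iff₀ h4 h3]
            linarith [hmlow n]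
        _ = G n * (n * t n ^ 2) := by
            simp only [hG]
            field_simp
        _ ≤ _ := by gcongr
    have h12 : Real.exp (-((3 + r) / 4 * (n * t n ^ 2))) ≤ 2 * Real.exp (-(n * t n ^ 2)) := by
      refine (Real.exp_le_exp.mpr (neg_le_neg h11)).trans (h10.trans ?_)
      have : Real.exp (-(2 * (n * t n ^ 2))) ≤ Real.exp (-(n * t n ^ 2)) :=
        Real.exp_le_exp.mpr (by linarith)
      linarith
    have h13 : 2 * Real.exp (-(n * t n ^ 2)) < Real.exp (-((3 + r) / 4 * (n * t n ^ 2))) := by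
      nth_rw 1 [← Real.exp_log (show (0 : ℝ) < 2 by norm_num)]
      rw [← Real.exp_add, Real.exp_lt_exp]
      rw [div_lt_iff₀ (by linarith)] at h9
      linarith
    linarith
  · rw [hmy]
    have := mul_le_mul_of_nonneg_right (hmlow n) hH.le
    have e : (n : ℝ) * (a / H - c * t n) * H = n * a - n * (H * c * t n) := by
      field_simp
    linarith

/-- Moderate deviation expansion of the optimal entanglement-direction conversion rate
in the resonance-degenerate case `V(p) = 0`. -/
theorem entanglement_direction_zero_variance
    {dp dq ds : ℕ} (p : Fin dp → ℝ) (q : Fin dq → ℝ) (s : Fin ds → ℝ)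
    (hp : IsProbDist p) (hq : IsProbDist q)
    (hs : IsProbDist s) (hsharp : IsSharp s)
    (hHp : 0 < shannonH p) (hHq : 0 < shannonH q)
    (hVp : entV p = 0) (hVq : 0 < entV q)
    (t : ℕ → ℝ) (ht : ModerateSeq t)
    (ε : ℕ → ℝ) (hε : ∀ n : ℕ, ε n = Real.exp (-((n : ℝ) * t n ^ 2)))
    (R : ℕ → ℝ → ℝ)
    (hR : ∀ n : ℕ, ∀ e : ℝ, 0 ≤ e → R n e =
      (↑(sSup {m : ℕ | ApproxSubMajTV (tensor (tpow p n) (tpow s m))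
          (tensor (tpow q m) (tpow s n)) e}) : ℝ) / (n : ℝ)) :
    Tendsto (fun n : ℕ => (R n (ε n) - shannonH p / shannonH q) / t n) atTop
      (𝓝 (-Real.sqrt (2 * entV q * shannonH p / shannonH q ^ 3))) := by
  classical
  set a := shannonH p with ha
  set H := shannonH q with hH
  set V := entV q with hV
  set c₀ := Real.sqrt (2 * V * a / H ^ 3) with hc₀
  have hc₀0 : 0 < c₀ := Real.sqrt_pos.mpr (by positivity)
  have hc₀sq : c₀ ^ 2 * H ^ 3 = 2 * V * a := by
    rw [hc₀, Real.sq_sqrt (by positivity)]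
    field_simp
  set K : ℕ → ℕ := fun n => sSup {m : ℕ | ApproxSubMajTV (tensor (tpow p n) (tpow s m))
    (tensor (tpow q m) (tpow s n)) (ε n)} with hK
  have hRK : ∀ n, R n (ε n) = K n / n := fun n =>
    hR n (ε n) (by rw [hε]; exact (Real.exp_pos _).le)
  have hset : ∀ᶠ n : ℕ in atTop, ∀ m, ApproxSubMajTV (tensor (tpow p n) (tpow s m))
      (tensor (tpow q m) (tpow s n)) (ε n) ↔
        ∃ A : Finset (Fin m → Fin dq), (A.card : ℝ) * Real.exp (-(n * a)) ≤ 1 ∧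
          1 - Real.exp (-(n * t n ^ 2)) ≤ ∑ x ∈ A, tpow q m x := by
    filter_upwards [ht.tendsto_nat_mul_sq.eventually_gt_atTop 0] with n hn m
    rw [hε n]
    exact approxSubMajTV_iff_exists_finset hp hq hs hsharp hVp n m
      (by rw [Real.exp_lt_one_iff]; linarith)
  have hbound : ∀ c, 0 < c → c < c₀ → ∀ᶠ n : ℕ in atTop,
      ∀ m, ApproxSubMajTV (tensor (tpow p n) (tpow s m)) (tensor (tpow q m) (tpow s n)) (ε n) →
        m ≤ ⌈n * (a / H - c * t n)⌉₊ := by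
    intro c hc hcc
    have hlt : c ^ 2 * H ^ 3 < 2 * V * a := by rw [← hc₀sq]; gcongr
    filter_upwards [hset, eventually_not_exists_finset hq hHq hVq ht hHp hc hlt] with n h1 h2 m hm
    by_contra hmn
    exact h2 (exists_finset_tpow_mono hq (Real.exp_pos _).le (not_le.mp hmn).le ((h1 m).mp hm))
  have hupper : ∀ c, 0 < c → c < c₀ → ∀ᶠ n : ℕ in atTop, K n ≤ ⌈n * (a / H - c * t n)⌉₊ := by
    intro c hc hcc
    filter_upwards [hbound c hc hcc] with n h1
    exact csSup_le' h1
  have hlower : ∀ c, c₀ < c → ∀ᶠ n : ℕ in atTop, ⌊n * (a / H - c * t n)⌋₊ ≤ K n := by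
    intro c hcc
    have hc : 0 < c := hc₀0.trans hcc
    have hlt : 2 * V * a < c ^ 2 * H ^ 3 := by rw [← hc₀sq]; gcongr
    filter_upwards [hset, eventually_exists_finset hq hHq hVq ht hHp hc hlt,
      hbound (c₀ / 2) (by positivity) (by linarith)] with n h1 h2 h3
    exact le_csSup ⟨_, h3⟩ ((h1 _).mpr h2)
  have hsmall : ∀ e : ℝ, 0 < e → ∀ᶠ n : ℕ in atTop, 1 < e * (n * t n) := by
    intro e he
    exact (ht.tendsto_nat_mul.const_mul_atTop he).eventually_gt_atTop 1
  refine tendsto_order.mpr ⟨fun b hb => ?_, fun b hb => ?_⟩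
  · filter_upwards [hlower ((c₀ - b) / 2) (by linarith), hsmall ((-c₀ - b) / 2) (by linarith),
      ht.eventually_pos, eventually_gt_atTop 0] with n h1 h2 h3 h4
    have hn : (0 : ℝ) < n := by exact_mod_cast h4
    have h5 := Nat.lt_floor_add_one (n * (a / H - (c₀ - b) / 2 * t n))
    have h6 : (⌊n * (a / H - (c₀ - b) / 2 * t n)⌋₊ : ℝ) ≤ K n := by exact_mod_cast h1
    rw [hRK, lt_div_iff₀ h3, lt_sub_iff_add_lt, lt_div_iff₀ hn]
    linarith
  · set c := max ((c₀ - b) / 2) (c₀ / 2) with hc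
    have hc1 : (c₀ - b) / 2 ≤ c := le_max_left _ _
    have hc2 : c₀ / 2 ≤ c := le_max_right _ _
    filter_upwards [hupper c (by linarith) (max_lt (by linarith) (by linarith)),
      hsmall ((c₀ + b) / 2) (by linarith),
      ht.eventually_pos, eventually_gt_atTop 0,
      (ht.1.const_mul c).eventually_lt_const (show c * 0 < a / H by rw [mul_zero]; positivity)]
      with n h1 h2 h3 h4 h5
    have hn : (0 : ℝ) < n := by exact_mod_cast h4
    have h6 := Nat.ceil_lt_add_one
      (show 0 ≤ (n : ℝ) * (a / H - c * t n) from mul_nonneg hn.le (by linarith))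
    have h7 : (K n : ℝ) ≤ ⌈n * (a / H - c * t n)⌉₊ := by exact_mod_cast h1
    rw [hRK, div_lt_iff₀ h3, sub_lt_iff_lt_add, div_lt_iff₀ hn]
    have h8 : (c₀ + b) / 2 * (n * t n) ≤ (c + b) * (n * t n) :=
      mul_le_mul_of_nonneg_right (by linarith) (by positivity)
    linarith
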